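/- (Path simulation by the projection environment) Let G be a balanced, projectable global type tree, Γ a local type environment with Γ ⊨ G, and Γ_proj = { p : G↾p | p ∈ parts(G) }. For every environment reduction path Γ = Γ_0 --λ_0--> Γ_1 --λ_1--> ⋯ there exists an environment reduction path Γ_proj = Γ'_0 --λ_0--> Γ'_1 --λ_1--> ⋯ with the same sequence of transition labels such that for every index n, Γ_n is a pointwise subtype of Γ'_n, i.e. Γ_n(p) ≤ Γ'_n(p) for all p ∈ dom(Γ'_n). -/

import Mathlib

set_option maxHeartbeats 1000000

/-! # Multiparty session types: global/local type trees and session calculus -/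

/-- Participants. -/
abbrev Prt : Type := ℕ

/-- Sorts. -/
inductive Srt : Type
  | nat | int | bool
  deriving DecidableEq

/-- Subsorting: the least reflexive relation with `nat ≤: int`. -/
inductive Subsort : Srt → Srt → Prop
  | refl (s : Srt) : Subsort s s
  | natint : Subsort .nat .int

/-! ## Local type trees (coinductive trees as coherent path labellings) -/

/-- Node labels of local type trees: the continuation list stores, at position `ℓ`,
`some S` when message label `ℓ` is present with payload sort `S`. -/
inductive LHead : Type
  | endH : LHead
  | recvH (p : Prt) (cs : List (Option Srt)) : LHead
  | sendH (p : Prt) (cs : List (Option Srt)) : LHead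
  deriving DecidableEq

/-- `h.branch i` : `i` is a valid child index of a node with head `h`. -/
def LHead.branch : LHead → ℕ → Prop
  | .endH, _ => False
  | .recvH _ cs, i => ∃ S, cs[i]? = some (some S)
  | .sendH _ cs, i => ∃ S, cs[i]? = some (some S)

/-- Local type trees: possibly infinite trees, represented by the assignment of a head
to each path from the root (paths are read root-first, extended at the right end). -/
structure Ltt : Type where
  node : List ℕ → Option LHead
  root : node [] ≠ none
  coh : ∀ l i, (node (l ++ [i]) ≠ none ↔ ∃ h, node l = some h ∧ h.branch i)

/-- The `i`-th child subtree of a local type tree (junk value if `i` is not a valid branch). -/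
noncomputable def Ltt.child (T : Ltt) (i : ℕ) : Ltt :=
  haveI := Classical.propDecidable (∃ T' : Ltt, ∀ l, T'.node l = T.node (i :: l))
  if h : ∃ T' : Ltt, ∀ l, T'.node l = T.node (i :: l) then h.choose else T

/-- One-step unfolding of the subtyping relation. -/
def SubF (R : Ltt → Ltt → Prop) (T T' : Ltt) : Prop :=
  (T.node [] = some .endH ∧ T'.node [] = some .endH) ∨
  (∃ p cs cs', T.node [] = some (.recvH p cs) ∧ T'.node [] = some (.recvH p cs') ∧
    ∀ i S', cs'[i]? = some (some S') →
      ∃ S, cs[i]? = some (some S) ∧ Subsort S' S ∧ R (T.child i) (T'.child i)) ∨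
  (∃ p cs cs', T.node [] = some (.sendH p cs) ∧ T'.node [] = some (.sendH p cs') ∧
    ∀ i S, cs[i]? = some (some S) →
      ∃ S', cs'[i]? = some (some S') ∧ Subsort S S' ∧ R (T.child i) (T'.child i))

/-- Subtyping: the largest relation `R` with `R ⊆ SubF R`. -/
def SubT (T T' : Ltt) : Prop :=
  ∃ R : Ltt → Ltt → Prop, (∀ a b, R a b → SubF R a b) ∧ R T T'

/-! ## Global type trees -/

/-- Node labels of global type trees. -/
inductive GHead : Type
  | endH : GHead
  | commH (p q : Prt) (cs : List (Option Srt)) : GHead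
  deriving DecidableEq

def GHead.branch : GHead → ℕ → Prop
  | .endH, _ => False
  | .commH _ _ cs, i => ∃ S, cs[i]? = some (some S)

/-- Global type trees. -/
structure Gtt : Type where
  node : List ℕ → Option GHead
  root : node [] ≠ none
  coh : ∀ l i, (node (l ++ [i]) ≠ none ↔ ∃ h, node l = some h ∧ h.branch i)

/-- The `i`-th child subtree of a global type tree (junk value if `i` is invalid). -/
noncomputable def Gtt.child (G : Gtt) (i : ℕ) : Gtt :=
  haveI := Classical.propDecidable (∃ G' : Gtt, ∀ l, G'.node l = G.node (i :: l))
  if h : ∃ G' : Gtt, ∀ l, G'.node l = G.node (i :: l) then h.choose else G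

/-- `IsPart r G` : `r ∈ parts(G)` (the least such set of participants). -/
inductive IsPart (r : Prt) : Gtt → Prop
  | here {G : Gtt} {p q : Prt} {cs} :
      G.node [] = some (.commH p q cs) → (r = p ∨ r = q) → IsPart r G
  | there {G : Gtt} {p q : Prt} {cs i S} :
      G.node [] = some (.commH p q cs) → cs[i]? = some (some S) →
      IsPart r (G.child i) → IsPart r G

/-! ## Projection (coinductive, plain merge) -/

def ProjF (R : Gtt → Prt → Ltt → Prop) (G : Gtt) (r : Prt) (T : Ltt) : Prop :=
  (¬ IsPart r G → T.node [] = some .endH) ∧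
  (∀ p cs, G.node [] = some (.commH p r cs) →
    T.node [] = some (.recvH p cs) ∧
    ∀ i S, cs[i]? = some (some S) → R (G.child i) r (T.child i)) ∧
  (∀ q cs, G.node [] = some (.commH r q cs) →
    T.node [] = some (.sendH q cs) ∧
    ∀ i S, cs[i]? = some (some S) → R (G.child i) r (T.child i)) ∧
  (∀ p q cs, G.node [] = some (.commH p q cs) → r ≠ p → r ≠ q →
    ∀ i S, cs[i]? = some (some S) → R (G.child i) r T)

/-- Projection `G ↾ r T`: the largest relation satisfying the projection clauses. -/
def Proj (G : Gtt) (r : Prt) (T : Ltt) : Prop :=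
  ∃ R : Gtt → Prt → Ltt → Prop, (∀ g p t, R g p t → ProjF R g p t) ∧ R G r T

/-- `G` is projectable onto every participant. -/
def Projectable (G : Gtt) : Prop := ∀ p, ∃ T, Proj G p T

/-! ## Balancedness -/

/-- `Subtree G G'` : `G'` is a subtree of `G`. -/
inductive Subtree : Gtt → Gtt → Prop
  | refl (G : Gtt) : Subtree G G
  | child {G G' : Gtt} {p q : Prt} {cs i S} :
      Subtree G G' → G'.node [] = some (.commH p q cs) → cs[i]? = some (some S) →
      Subtree G (G'.child i)

/-- `Occ r k G` : the participant `r` occurs on every path from the root of `G` that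
has length at least `k` or ends in `end`. -/
inductive Occ (r : Prt) : ℕ → Gtt → Prop
  | here {k} {G : Gtt} {p q : Prt} {cs} :
      G.node [] = some (.commH p q cs) → (r = p ∨ r = q) → Occ r k G
  | step {k} {G : Gtt} {p q : Prt} {cs} :
      G.node [] = some (.commH p q cs) →
      (∀ i S, cs[i]? = some (some S) → Occ r k (G.child i)) → Occ r (k + 1) G

/-- Balanced global type trees. -/
def BalancedG (G : Gtt) : Prop :=
  ∀ G', Subtree G G' → ∃ k, ∀ r, IsPart r G' → Occ r k G'

/-! ## g-contexts and grafting -/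

/-- Global type tree contexts (finite prefixes with numbered holes). -/
inductive GCtx : Type
  | hole (j : ℕ) : GCtx
  | comm (p q : Prt) (cs : List (Option (Srt × GCtx))) : GCtx

/-- Participants of a g-context. -/
inductive CtxPart (r : Prt) : GCtx → Prop
  | here {p q : Prt} {cs} : (r = p ∨ r = q) → CtxPart r (.comm p q cs)
  | there {p q : Prt} {cs : List (Option (Srt × GCtx))} {i : ℕ} {S : Srt} {C : GCtx} :
      cs[i]? = some (some (S, C)) → CtxPart r C → CtxPart r (.comm p q cs)

/-- `Graft σ C G` : grafting the indexed family `σ` of global type trees onto the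
g-context `C` yields the global type tree `G`. -/
inductive Graft (σ : ℕ → Option Gtt) : GCtx → Gtt → Prop
  | hole {j : ℕ} {G : Gtt} : σ j = some G → Graft σ (.hole j) G
  | comm {p q : Prt} {cs : List (Option (Srt × GCtx))} {G : Gtt} :
      G.node [] = some (.commH p q (cs.map (Option.map Prod.fst))) →
      (∀ i S C, cs[i]? = some (some (S, C)) → Graft σ C (G.child i)) →
      Graft σ (.comm p q cs) G

/-- `Gj` has the shape `end`, `p→q{…}` or `q→p{…}` for some `q`. -/
def GoodAt (p : Prt) (Gj : Gtt) : Prop :=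
  Gj.node [] = some .endH ∨
  (∃ q cs, Gj.node [] = some (.commH p q cs)) ∨
  (∃ q cs, Gj.node [] = some (.commH q p cs))

/-! ## Transition labels and local type environments -/

/-- Transition labels: `recvL p q S ℓ` = `p?q:ℓ(S)` (p receives from q),
`sendL p q S ℓ` = `p!q:ℓ(S)` (p sends to q), `commL p q ℓ` = `(p,q)ℓ`. -/
inductive TLabel : Type
  | recvL (p q : Prt) (S : Srt) (l : ℕ)
  | sendL (p q : Prt) (S : Srt) (l : ℕ)
  | commL (p q : Prt) (l : ℕ)

def TLabel.subj : TLabel → Set Prt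
  | .recvL p _ _ _ => {p}
  | .sendL p _ _ _ => {p}
  | .commL p q _ => {p, q}

/-- Local type environments: finite maps from participants to local type trees. -/
abbrev Env : Type := Prt → Option Ltt

/-- The environment is a *finite* map. -/
def EnvFin (Γ : Env) : Prop := {p : Prt | Γ p ≠ none}.Finite

def Env.single (p : Prt) (T : Ltt) : Env := fun r => if r = p then some T else none
def Env.upd (Γ : Env) (p : Prt) (T : Ltt) : Env := fun r => if r = p then some T else Γ r
def Env.union (Γ₁ Γ₂ : Env) : Env := fun r => (Γ₁ r).orElse (fun _ => Γ₂ r)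
def Env.disj (Γ₁ Γ₂ : Env) : Prop := ∀ r, Γ₁ r = none ∨ Γ₂ r = none

/-- Typing environment transitions. -/
inductive EStep : Env → TLabel → Env → Prop
  | recv {p q : Prt} {T : Ltt} {cs k S} :
      T.node [] = some (.recvH q cs) → cs[k]? = some (some S) →
      EStep (Env.single p T) (.recvL p q S k) (Env.single p (T.child k))
  | send {p q : Prt} {T : Ltt} {cs k S} :
      T.node [] = some (.sendH q cs) → cs[k]? = some (some S) →
      EStep (Env.single p T) (.sendL p q S k) (Env.single p (T.child k))
  | ext {Γ Γ' : Env} {α : TLabel} {p : Prt} {T : Ltt} :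
      EStep Γ α Γ' → Γ p = none →
      EStep (Γ.upd p T) α (Γ'.upd p T)
  | comm {Γ₁ Γ₁' Γ₂ Γ₂' : Env} {p q : Prt} {S S' : Srt} {k : ℕ} :
      EStep Γ₁ (.sendL p q S k) Γ₁' → EStep Γ₂ (.recvL q p S' k) Γ₂' →
      Subsort S S' → Env.disj Γ₁ Γ₂ →
      EStep (Γ₁.union Γ₂) (.commL p q k) (Γ₁'.union Γ₂')

/-- `Γ --α-->` : some `α`-transition is enabled. -/
def CanE (Γ : Env) (α : TLabel) : Prop := ∃ Γ', EStep Γ α Γ'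

/-- `Γ → Γ'` : a synchronised communication reduction. -/
def EnvRed (Γ Γ' : Env) : Prop := ∃ p q l, EStep Γ (.commL p q l) Γ'

/-! ## Global type transitions (coinductive) -/

def GStepF (R : Gtt → TLabel → Gtt → Prop) (G : Gtt) (α : TLabel) (G' : Gtt) : Prop :=
  (∃ p q cs k S, G.node [] = some (.commH p q cs) ∧ cs[k]? = some (some S) ∧
    α = .commL p q k ∧ G' = G.child k) ∨
  (∃ p q cs, G.node [] = some (.commH p q cs) ∧ G'.node [] = some (.commH p q cs) ∧
    α.subj ∩ ({p, q} : Set Prt) = ∅ ∧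
    (∀ i S, cs[i]? = some (some S) →
      IsPart p (G.child i) ∧ IsPart q (G.child i) ∧ R (G.child i) α (G'.child i)))

/-- Global type transitions: the largest relation `R` with `R ⊆ GStepF R`. -/
def GStep (G : Gtt) (α : TLabel) (G' : Gtt) : Prop :=
  ∃ R : Gtt → TLabel → Gtt → Prop, (∀ a b c, R a b c → GStepF R a b c) ∧ R G α G'

/-! ## Association -/

/-- `Γ ⊨ G` : the local type environment `Γ` is associated with the global type tree `G`. -/
def Assoc (Γ : Env) (G : Gtt) : Prop :=
  (∀ p, IsPart p G → ∃ T Tp, Γ p = some T ∧ Proj G p Tp ∧ SubT T Tp) ∧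
  (∀ p, ¬ IsPart p G → Γ p = none ∨ ∃ T, Γ p = some T ∧ T.node [] = some .endH)

/-- `Γ` is the environment of direct projections of `G`:
`Γ = { p : G↾p | p ∈ parts(G) }`. -/
def IsProjEnv (G : Gtt) (Γ : Env) : Prop :=
  (∀ p, IsPart p G → ∃ T, Γ p = some T ∧ Proj G p T) ∧
  (∀ p, ¬ IsPart p G → Γ p = none)

/-! ## Safety of environments -/

def SafeF (R : Env → Prop) (Γ : Env) : Prop :=
  (∀ p q S S' k k', CanE Γ (.sendL p q S k) → CanE Γ (.recvL q p S' k') →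
    CanE Γ (.commL p q k)) ∧
  (∀ p q k Γ', EStep Γ (.commL p q k) Γ' → R Γ')

/-- `safe` : the largest set of environments closed under the safety clauses. -/
def Safe (Γ : Env) : Prop :=
  ∃ R : Env → Prop, (∀ a, R a → SafeF R a) ∧ R Γ

/-! ## Environment reduction paths, fairness and liveness -/

/-- A possibly infinite environment reduction path
`Γ₀ --(p₀,q₀)ℓ₀--> Γ₁ --(p₁,q₁)ℓ₁--> ⋯`; `alive n` means the `n`-th transition exists. -/
structure EnvPath : Type where
  st : ℕ → Env
  lb : ℕ → Prt × Prt × ℕ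
  alive : ℕ → Prop
  down : ∀ n, alive (n + 1) → alive n
  step : ∀ n, alive n →
    EStep (st n) (.commL (lb n).1 (lb n).2.1 (lb n).2.2) (st (n + 1))

/-- The state of index `n` is on the path. -/
def EnvPath.valid (ρ : EnvPath) : ℕ → Prop
  | 0 => True
  | n + 1 => ρ.alive n

/-- Fair environment reduction paths. -/
def FairEPath (ρ : EnvPath) : Prop :=
  ∀ n p q, ρ.valid n → (∃ l, CanE (ρ.st n) (.commL p q l)) →
    ∃ m, n ≤ m ∧ ρ.alive m ∧ ∃ l', ρ.lb m = (p, q, l')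

/-- Live environment reduction paths. -/
def LiveEPath (ρ : EnvPath) : Prop :=
  ∀ n, ρ.valid n →
    (∀ p q S l, CanE (ρ.st n) (.sendL p q S l) →
      ∃ m, n ≤ m ∧ ρ.alive m ∧ ∃ l', ρ.lb m = (p, q, l')) ∧
    (∀ p q S l, CanE (ρ.st n) (.recvL q p S l) →
      ∃ m, n ≤ m ∧ ρ.alive m ∧ ∃ l', ρ.lb m = (p, q, l'))

/-- Live local type environments. -/
def LiveEnv (Γ : Env) : Prop :=
  ∀ Γ', Relation.ReflTransGen EnvRed Γ Γ' →
    ∀ ρ : EnvPath, ρ.st 0 = Γ' → FairEPath ρ → LiveEPath ρ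

/-! ## Expressions -/

inductive Expr : Type
  | var (n : ℕ)
  | cnat (n : ℕ)
  | cint (z : ℤ)
  | cbool (b : Bool)
  | succ (e : Expr)
  | neg (e : Expr)
  | enot (e : Expr)
  | choice (e₁ e₂ : Expr)

def Expr.IsVal : Expr → Prop
  | .cnat _ => True
  | .cint _ => True
  | .cbool _ => True
  | _ => False

/-- Expression evaluation `e ↓ v`. -/
inductive Eval : Expr → Expr → Prop
  | vnat (n : ℕ) : Eval (.cnat n) (.cnat n)
  | vint (z : ℤ) : Eval (.cint z) (.cint z)
  | vbool (b : Bool) : Eval (.cbool b) (.cbool b)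
  | succ {e n} : Eval e (.cnat n) → Eval (.succ e) (.cnat (n + 1))
  | neg {e z} : Eval e (.cint z) → Eval (.neg e) (.cint (-z))
  | enot {e b} : Eval e (.cbool b) → Eval (.enot e) (.cbool !b)
  | chl {e₁ e₂ v} : Eval e₁ v → Eval (.choice e₁ e₂) v
  | chr {e₁ e₂ v} : Eval e₂ v → Eval (.choice e₁ e₂) v

/-- Substitution of a (closed) expression `v` for the expression variable `n`. -/
def Expr.subst (v : Expr) (n : ℕ) : Expr → Expr
  | .var m => if m = n then v else .var m
  | .cnat k => .cnat k
  | .cint z => .cint z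
  | .cbool b => .cbool b
  | .succ e => .succ (Expr.subst v n e)
  | .neg e => .neg (Expr.subst v n e)
  | .enot e => .enot (Expr.subst v n e)
  | .choice e₁ e₂ => .choice (Expr.subst v n e₁) (Expr.subst v n e₂)

/-- Expression typing (expression variables are de Bruijn indices). -/
inductive ETyp : List (Option Srt) → Expr → Srt → Prop
  | var {Θ n S} : Θ[n]? = some (some S) → ETyp Θ (.var n) S
  | cnat {Θ n} : ETyp Θ (.cnat n) .nat
  | cint {Θ z} : ETyp Θ (.cint z) .int
  | cbool {Θ b} : ETyp Θ (.cbool b) .bool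
  | succ {Θ e} : ETyp Θ e .nat → ETyp Θ (.succ e) .nat
  | neg {Θ e} : ETyp Θ e .int → ETyp Θ (.neg e) .int
  | enot {Θ e} : ETyp Θ e .bool → ETyp Θ (.enot e) .bool
  | choice {Θ e₁ e₂ S} : ETyp Θ e₁ S → ETyp Θ e₂ S → ETyp Θ (.choice e₁ e₂) S
  | sub {Θ e S S'} : ETyp Θ e S → Subsort S S' → ETyp Θ e S'

/-! ## Processes and sessions -/

/-- Processes (process and expression variables are de Bruijn indices; the receive
continuation list stores `some P` at the positions of available message labels). -/
inductive Proc : Type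
  | send (q : Prt) (l : ℕ) (e : Expr) (P : Proc)
  | recv (q : Prt) (Ps : List (Option Proc))
  | ite (e : Expr) (P Q : Proc)
  | mu (P : Proc)
  | pvar (n : ℕ)
  | inact

/-- Substitution of a (closed) value `v` for the expression variable `n` in a process. -/
inductive SubstE (v : Expr) : ℕ → Proc → Proc → Prop
  | send {n q l e P P'} : SubstE v n P P' →
      SubstE v n (.send q l e P) (.send q l (Expr.subst v n e) P')
  | recv {n q} {Ps Ps' : List (Option Proc)} :
      Ps.length = Ps'.length →
      (∀ i : ℕ, (∃ P, Ps[i]? = some (some P)) ↔ (∃ P', Ps'[i]? = some (some P'))) →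
      (∀ (i : ℕ) P P', Ps[i]? = some (some P) → Ps'[i]? = some (some P') → SubstE v (n + 1) P P') →
      SubstE v n (.recv q Ps) (.recv q Ps')
  | ite {n e P P' Q Q'} : SubstE v n P P' → SubstE v n Q Q' →
      SubstE v n (.ite e P Q) (.ite (Expr.subst v n e) P' Q')
  | mu {n P P'} : SubstE v n P P' → SubstE v n (.mu P) (.mu P')
  | pvar {n m} : SubstE v n (.pvar m) (.pvar m)
  | inact {n} : SubstE v n .inact .inact

/-- Substitution of a (closed) process `R` for the process variable `n`. -/
inductive SubstP (R : Proc) : ℕ → Proc → Proc → Prop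
  | send {n q l e P P'} : SubstP R n P P' → SubstP R n (.send q l e P) (.send q l e P')
  | recv {n q} {Ps Ps' : List (Option Proc)} :
      Ps.length = Ps'.length →
      (∀ i : ℕ, (∃ P, Ps[i]? = some (some P)) ↔ (∃ P', Ps'[i]? = some (some P'))) →
      (∀ (i : ℕ) P P', Ps[i]? = some (some P) → Ps'[i]? = some (some P') → SubstP R n P P') →
      SubstP R n (.recv q Ps) (.recv q Ps')
  | ite {n e P P' Q Q'} : SubstP R n P P' → SubstP R n Q Q' →
      SubstP R n (.ite e P Q) (.ite e P' Q')
  | mu {n P P'} : SubstP R (n + 1) P P' → SubstP R n (.mu P) (.mu P')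
  | pvarEq {n} : SubstP R n (.pvar n) R
  | pvarNe {n m} : m ≠ n → SubstP R n (.pvar m) (.pvar m)
  | inact {n} : SubstP R n .inact .inact

/-- Multiparty sessions. -/
inductive Session : Type
  | single (p : Prt) (P : Proc)
  | par (M N : Session)
  | zero

/-- Structural congruence on sessions. -/
inductive SCong : Session → Session → Prop
  | refl (M) : SCong M M
  | symm {M N} : SCong M N → SCong N M
  | trans {M N K} : SCong M N → SCong N K → SCong M K
  | parComm (M N) : SCong (.par M N) (.par N M)
  | parAssoc (M N K) : SCong (.par (.par M N) K) (.par M (.par N K))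
  | parZero (M) : SCong (.par M .zero) M
  | parCong {M M' N N'} : SCong M M' → SCong N N' → SCong (.par M N) (.par M' N')

/-- Unfolding `M ⇛ N`. -/
inductive Unfold : Session → Session → Prop
  | struct {M N} : SCong M N → Unfold M N
  | iteT {p e P Q N} : Eval e (.cbool true) →
      Unfold (.par (.single p (.ite e P Q)) N) (.par (.single p P) N)
  | iteF {p e P Q N} : Eval e (.cbool false) →
      Unfold (.par (.single p (.ite e P Q)) N) (.par (.single p Q) N)
  | recUnf {p P P' N} : SubstP (.mu P) 0 P P' →
      Unfold (.par (.single p (.mu P)) N) (.par (.single p P') N)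
  | trans {M M' N} : Unfold M M' → Unfold M' N → Unfold M N

/-- Session transition labels `(p,q)ℓ` : `p` sends to `q` with message label `ℓ`. -/
abbrev SLbl : Type := Prt × Prt × ℕ

/-- Labelled session reductions. -/
inductive SStep : Session → SLbl → Session → Prop
  | comm {p q : Prt} {Ps : List (Option Proc)} {j : ℕ} {e v : Expr} {Pj Pj' Q : Proc}
      {N : Session} :
      Ps[j]? = some (some Pj) → Eval e v → SubstE v 0 Pj Pj' →
      SStep (.par (.single p (.recv q Ps)) (.par (.single q (.send p j e Q)) N))
            (q, p, j)
            (.par (.single p Pj') (.par (.single q Q) N))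
  | unf {M M' N N' : Session} {l : SLbl} :
      Unfold M M' → SStep M' l N' → Unfold N' N → SStep M l N

/-- `M → N` : some labelled reduction. -/
def SRed (M N : Session) : Prop := ∃ l, SStep M l N

/-- `p` runs `P` in `M`. -/
inductive InSess : Session → Prt → Proc → Prop
  | single {p P} : InSess (.single p P) p P
  | parL {M N p P} : InSess M p P → InSess (.par M N) p P
  | parR {M N p P} : InSess N p P → InSess (.par M N) p P

/-- Every process of the session is inactive: `Π p_i ◁ 0`. -/
inductive AllInact : Session → Prop
  | single (p : Prt) : AllInact (.single p .inact)
  | par {M N} : AllInact M → AllInact N → AllInact (.par M N)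
  | zero : AllInact .zero

/-! ## Process and session typing -/

/-- Process typing `Θ ⊢ P : T` (expression context, process-variable context). -/
inductive PTyp : List (Option Srt) → List Ltt → Proc → Ltt → Prop
  | inact {Θe Θp T} : T.node [] = some .endH → PTyp Θe Θp .inact T
  | pvar {Θe Θp n T} : Θp[n]? = some T → PTyp Θe Θp (.pvar n) T
  | mu {Θe Θp P T} : PTyp Θe (T :: Θp) P T → PTyp Θe Θp (.mu P) T
  | ite {Θe Θp e P Q T} : ETyp Θe e .bool → PTyp Θe Θp P T → PTyp Θe Θp Q T →
      PTyp Θe Θp (.ite e P Q) T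
  | sub {Θe Θp P T T'} : PTyp Θe Θp P T → SubT T T' → PTyp Θe Θp P T'
  | recv {Θe Θp q Ps T ss} : T.node [] = some (.recvH q ss) →
      Ps.length = ss.length →
      (∀ i : ℕ, (∃ P, Ps[i]? = some (some P)) ↔ (∃ S, ss[i]? = some (some S))) →
      (∀ (i : ℕ) P S, Ps[i]? = some (some P) → ss[i]? = some (some S) →
        PTyp (some S :: Θe) Θp P (T.child i)) →
      PTyp Θe Θp (.recv q Ps) T
  | send {Θe Θp q l e P T T' S ss} : ETyp Θe e S → PTyp Θe Θp P T' →
      T.node [] = some (.sendH q ss) → ss[l]? = some (some S) →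
      (∀ i S', ss[i]? = some (some S') → i = l) →
      T.child l = T' →
      PTyp Θe Θp (.send q l e P) T

/-- Session typing `Γ ⊢ M`. -/
def SessTyp (Γ : Env) (M : Session) : Prop :=
  (∀ p P Q, InSess M p P → InSess M p Q → P = Q) ∧
  (∀ p, (∃ P, InSess M p P) ↔ Γ p ≠ none) ∧
  ∃ G : Gtt, BalancedG G ∧ Projectable G ∧ Assoc Γ G ∧
    (∀ p P, InSess M p P → ∃ T, Γ p = some T ∧ PTyp [] [] P T)

/-! ## Session reduction paths and session liveness -/

/-- A possibly infinite session reduction path. -/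
structure SPath : Type where
  st : ℕ → Session
  lb : ℕ → SLbl
  alive : ℕ → Prop
  down : ∀ n, alive (n + 1) → alive n
  step : ∀ n, alive n → SStep (st n) (lb n) (st (n + 1))

def SPath.valid (ρ : SPath) : ℕ → Prop
  | 0 => True
  | n + 1 => ρ.alive n

/-- Fair session reduction paths. -/
def FairSPath (ρ : SPath) : Prop :=
  ∀ n p q, ρ.valid n → (∃ l M', SStep (ρ.st n) (p, q, l) M') →
    ∃ m, n ≤ m ∧ ρ.alive m ∧ ∃ l', ρ.lb m = (p, q, l')

/-- Session liveness (lock-freedom under full fairness). -/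
def LiveSess (M : Session) : Prop :=
  (∀ M₁ (p q : Prt) (l : ℕ) (e : Expr) (Q : Proc) (N : Session),
    Relation.ReflTransGen SRed M M₁ →
    Unfold M₁ (.par (.single q (.send p l e Q)) N) →
    ∃ N', Relation.ReflTransGen SRed
      (.par (.single q (.send p l e Q)) N) (.par (.single q Q) N')) ∧
  (∀ M₁ (p q : Prt) (Qs : List (Option Proc)) (N : Session),
    Relation.ReflTransGen SRed M M₁ →
    Unfold M₁ (.par (.single q (.recv p Qs)) N) →
    ∃ (N' : Session) (i : ℕ) (Qi : Proc) (v : Expr) (Qi' : Proc), Qs[i]? = some (some Qi) ∧ v.IsVal ∧ SubstE v 0 Qi Qi' ∧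
      Relation.ReflTransGen SRed
        (.par (.single q (.recv p Qs)) N) (.par (.single q Qi') N'))

/-! ## Unfolding of the coinductive relations -/

theorem SubF.mono {R R' : Ltt → Ltt → Prop} (hR : ∀ a b, R a b → R' a b) {T T' : Ltt}
    (h : SubF R T T') : SubF R' T T' := by
  rcases h with h | ⟨p, cs, cs', h, h', hc⟩ | ⟨p, cs, cs', h, h', hc⟩
  · exact .inl h
  · refine .inr (.inl ⟨p, cs, cs', h, h', fun i S hi => ?_⟩)
    obtain ⟨S', hS, hs, hr⟩ := hc i S hi
    exact ⟨S', hS, hs, hR _ _ hr⟩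
  · refine .inr (.inr ⟨p, cs, cs', h, h', fun i S hi => ?_⟩)
    obtain ⟨S', hS, hs, hr⟩ := hc i S hi
    exact ⟨S', hS, hs, hR _ _ hr⟩

theorem SubT.unfold {T T' : Ltt} (h : SubT T T') : SubF SubT T T' := by
  obtain ⟨R, hR, h⟩ := h
  exact (hR _ _ h).mono fun a b hab => ⟨R, hR, hab⟩

theorem ProjF.mono {R R' : Gtt → Prt → Ltt → Prop} (hR : ∀ g r t, R g r t → R' g r t)
    {G : Gtt} {r : Prt} {T : Ltt} (h : ProjF R G r T) : ProjF R' G r T := by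
  obtain ⟨h₁, h₂, h₃, h₄⟩ := h
  exact ⟨h₁, fun p cs hG => ⟨(h₂ p cs hG).1, fun i S hi => hR _ _ _ ((h₂ p cs hG).2 i S hi)⟩,
    fun q cs hG => ⟨(h₃ q cs hG).1, fun i S hi => hR _ _ _ ((h₃ q cs hG).2 i S hi)⟩,
    fun p q cs hG hp hq i S hi => hR _ _ _ (h₄ p q cs hG hp hq i S hi)⟩

theorem Proj.unfold {G : Gtt} {r : Prt} {T : Ltt} (h : Proj G r T) : ProjF Proj G r T := by
  obtain ⟨R, hR, h⟩ := h
  exact (hR _ _ _ h).mono fun g p t hab => ⟨R, hR, hab⟩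

/-! ## Projections of a global type are unique up to subtyping -/

/-- Two projections of `G` onto the same participant are either both `end`, or both are
projections of one and the same subtree whose root communication involves the participant. -/
theorem Proj.exists_common_head {G : Gtt} {r : Prt} {T₁ T₂ : Ltt}
    (h₁ : Proj G r T₁) (h₂ : Proj G r T₂) :
    (T₁.node [] = some .endH ∧ T₂.node [] = some .endH) ∨
    ∃ G' p q cs, Proj G' r T₁ ∧ Proj G' r T₂ ∧
      G'.node [] = some (.commH p q cs) ∧ (r = p ∨ r = q) := by
  by_cases hr : IsPart r G
  · right
    induction hr with
    | here hG hpq => exact ⟨_, _, _, _, h₁, h₂, hG, hpq⟩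
    | @there G p q cs i S hG hi _ ih =>
      by_cases hpq : r = p ∨ r = q
      · exact ⟨_, _, _, _, h₁, h₂, hG, hpq⟩
      · push Not at hpq
        exact ih (h₁.unfold.2.2.2 p q cs hG hpq.1 hpq.2 i S hi)
          (h₂.unfold.2.2.2 p q cs hG hpq.1 hpq.2 i S hi)
  · exact .inl ⟨h₁.unfold.1 hr, h₂.unfold.1 hr⟩

theorem SubT.of_proj {G : Gtt} {r : Prt} {T T₁ T₂ : Ltt}
    (h : SubT T T₁) (h₁ : Proj G r T₁) (h₂ : Proj G r T₂) : SubT T T₂ := by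
  refine ⟨fun a b => ∃ G c, SubT a c ∧ Proj G r c ∧ Proj G r b, ?_, G, T₁, h, h₁, h₂⟩
  rintro a b ⟨G, c, hac, hc, hb⟩
  rcases hc.exists_common_head hb with ⟨hce, hbe⟩ | ⟨G', p, q, cs, hc, hb, hG, rfl | rfl⟩
  · rcases hac.unfold with h | ⟨p, cs, cs', h, h', -⟩ | ⟨p, cs, cs', h, h', -⟩
    · exact .inl ⟨h.1, hbe⟩
    all_goals simp [hce] at h'
  · obtain ⟨hcn, hcc⟩ := hc.unfold.2.2.1 q cs hG
    obtain ⟨hbn, hbc⟩ := hb.unfold.2.2.1 q cs hG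
    rcases hac.unfold with h | ⟨p, cs, cs', h, h', -⟩ | ⟨p, cs, cs', h, h', hi⟩
    · simp [hcn] at h
    · simp [hcn] at h'
    · simp only [hcn, Option.some.injEq, LHead.sendH.injEq] at h'
      obtain ⟨rfl, rfl⟩ := h'
      refine .inr (.inr ⟨_, _, _, h, hbn, fun i S hiS => ?_⟩)
      obtain ⟨S', hS', hs, hsub⟩ := hi i S hiS
      exact ⟨S', hS', hs, _, _, hsub, hcc i S' hS', hbc i S' hS'⟩
  · obtain ⟨hcn, hcc⟩ := hc.unfold.2.1 p cs hG
    obtain ⟨hbn, hbc⟩ := hb.unfold.2.1 p cs hG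
    rcases hac.unfold with h | ⟨p, cs, cs', h, h', hi⟩ | ⟨p, cs, cs', h, h', -⟩
    · simp [hcn] at h
    · simp only [hcn, Option.some.injEq, LHead.recvH.injEq] at h'
      obtain ⟨rfl, rfl⟩ := h'
      refine .inr (.inl ⟨_, _, _, h, hbn, fun i S hiS => ?_⟩)
      obtain ⟨S', hS', hs, hsub⟩ := hi i S hiS
      exact ⟨S', hS', hs, _, _, hsub, hcc i S hiS, hbc i S hiS⟩
    · simp [hcn] at h'

/-! ## Executing one communication inside a global type -/

theorem Gtt.ext_node {G G' : Gtt} (h : ∀ l, G.node l = G'.node l) : G = G' := by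
  cases G; cases G'
  simp only [Gtt.mk.injEq]
  exact funext h

theorem Gtt.child_node {G : Gtt} {p q : Prt} {cs : List (Option Srt)} {i : ℕ} {S : Srt}
    (hG : G.node [] = some (.commH p q cs)) (hi : cs[i]? = some (some S)) (l : List ℕ) :
    (G.child i).node l = G.node (i :: l) := by
  have h : ∃ G' : Gtt, ∀ l, G'.node l = G.node (i :: l) :=
    ⟨⟨fun l => G.node (i :: l), (G.coh [] i).2 ⟨_, hG, S, hi⟩, fun l j => G.coh (i :: l) j⟩,
      fun _ => rfl⟩
  unfold Gtt.child
  rw [dif_pos h]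
  exact h.choose_spec l

/-- The root of the labelling `f` is a communication from `p` to `q` with a branch `k`. -/
def HeadOffers (p q : Prt) (k : ℕ) (f : List ℕ → Option GHead) : Prop :=
  ∃ cs S, f [] = some (.commH p q cs) ∧ cs[k]? = some (some S)

open Classical in
/-- The labelling obtained from `f` by executing, on every path, the first communication
from `p` to `q` that has a branch `k`, along that branch. -/
noncomputable def execNode (p q : Prt) (k : ℕ) :
    (List ℕ → Option GHead) → List ℕ → Option GHead
  | f, [] => if HeadOffers p q k f then f [k] else f []
  | f, i :: l =>
    if HeadOffers p q k f then f (k :: i :: l) else execNode p q k (fun l => f (i :: l)) l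

theorem execNode_pos {p q : Prt} {k : ℕ} {f : List ℕ → Option GHead}
    (h : HeadOffers p q k f) (l : List ℕ) : execNode p q k f l = f (k :: l) := by
  cases l <;> simp [execNode, h]

theorem execNode_root {p q : Prt} {k : ℕ} {f : List ℕ → Option GHead}
    (hf : ∀ l i, (f (l ++ [i]) ≠ none ↔ ∃ h, f l = some h ∧ h.branch i)) :
    execNode p q k f [] ≠ none ↔ f [] ≠ none := by
  by_cases h : HeadOffers p q k f
  · obtain ⟨cs, S, h₁, h₂⟩ := id h
    have := (hf [] k).2 ⟨_, h₁, S, h₂⟩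
    rw [execNode_pos h, h₁]
    simpa using this
  · simp [execNode, h]

theorem execNode_coh {p q : Prt} {k : ℕ} (l : List ℕ) (i : ℕ) :
    ∀ {f : List ℕ → Option GHead},
      (∀ l i, (f (l ++ [i]) ≠ none ↔ ∃ h, f l = some h ∧ h.branch i)) →
      (execNode p q k f (l ++ [i]) ≠ none ↔ ∃ h, execNode p q k f l = some h ∧ h.branch i) := by
  induction l with
  | nil =>
    intro f hf
    by_cases h : HeadOffers p q k f
    · rw [execNode_pos h, execNode_pos h]
      exact hf [k] i
    · have := execNode_root (p := p) (q := q) (k := k) (f := fun l => f (i :: l))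
        (fun l j => hf (i :: l) j)
      simp only [List.nil_append, execNode, h, if_false]
      exact this.trans (hf [] i)
  | cons j l ih =>
    intro f hf
    by_cases h : HeadOffers p q k f
    · rw [execNode_pos h, execNode_pos h]
      exact hf (k :: j :: l) i
    · simp only [List.cons_append, execNode, h, if_false]
      exact ih fun l i => hf (j :: l) i

/-- Execution of the communication `(p,q)k` in a global type tree. -/
noncomputable def Gtt.exec (p q : Prt) (k : ℕ) (G : Gtt) : Gtt where
  node := execNode p q k G.node
  root := (execNode_root G.coh).2 G.root
  coh l i := execNode_coh l i G.coh

section Exec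

variable {p q : Prt} {k : ℕ} {G : Gtt}

theorem Gtt.exec_of_head {cs : List (Option Srt)} {S : Srt}
    (hG : G.node [] = some (.commH p q cs)) (hk : cs[k]? = some (some S)) :
    G.exec p q k = G.child k :=
  Gtt.ext_node fun l => by
    rw [Gtt.child_node hG hk]
    exact execNode_pos ⟨cs, S, hG, hk⟩ l

theorem Gtt.exec_node_root {a b : Prt} {cs : List (Option Srt)}
    (hG : G.node [] = some (.commH a b cs)) (ha : a ≠ p) :
    (G.exec p q k).node [] = some (.commH a b cs) := by
  have h : ¬ HeadOffers p q k G.node := by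
    rintro ⟨cs', S, h, -⟩
    simp_all
  simp [Gtt.exec, execNode, h, hG]

theorem Gtt.exec_child {a b : Prt} {cs : List (Option Srt)} {i : ℕ} {S : Srt}
    (hG : G.node [] = some (.commH a b cs)) (ha : a ≠ p) (hi : cs[i]? = some (some S)) :
    (G.exec p q k).child i = (G.child i).exec p q k := by
  have h : ¬ HeadOffers p q k G.node := by
    rintro ⟨cs', S, h, -⟩
    simp_all
  refine Gtt.ext_node fun l => ?_
  rw [Gtt.child_node (Gtt.exec_node_root hG ha) hi]
  have : (fun l => G.node (i :: l)) = (G.child i).node :=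
    funext fun l => (Gtt.child_node hG hi l).symm
  simp [Gtt.exec, execNode, h, this]

end Exec

/-- In `G` the participants `p` and `q` are both ready for the communication `(p,q)k`:
they project to `Tp`, which sends to `q` and offers `k`, and to `Tq`, which receives from `p`. -/
structure Ready (p q : Prt) (k : ℕ) (cs cs' : List (Option Srt)) (S : Srt) (Tp Tq : Ltt)
    (G : Gtt) : Prop where
  send : Tp.node [] = some (.sendH q cs)
  recv : Tq.node [] = some (.recvH p cs')
  label : cs[k]? = some (some S)
  projSend : Proj G p Tp
  projRecv : Proj G q Tq

/-- The projection of `G` onto `r` after the communication `(p,q)k`. -/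
def NextProj (p q : Prt) (k : ℕ) (Tp Tq : Ltt) (G : Gtt) (r : Prt) (t : Ltt) : Prop :=
  (r = p ∧ t = Tp.child k) ∨ (r = q ∧ t = Tq.child k) ∨ (r ≠ p ∧ r ≠ q ∧ Proj G r t)

section Ready

variable {p q : Prt} {k : ℕ} {cs cs' : List (Option Srt)} {S : Srt} {Tp Tq : Ltt} {G : Gtt}

theorem Ready.isPart (h : Ready p q k cs cs' S Tp Tq G) : IsPart p G := by
  by_contra hp
  have := h.projSend.unfold.1 hp
  simp [h.send] at this

/-- The root of `G` is either the communication from `p` to `q`, or independent of it. -/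
theorem Ready.head (h : Ready p q k cs cs' S Tp Tq G) {a b : Prt} {ds : List (Option Srt)}
    (hG : G.node [] = some (.commH a b ds)) :
    (a = p ∧ b = q ∧ ds = cs ∧ cs = cs') ∨
    ((p ≠ a ∧ p ≠ b ∧ q ≠ a ∧ q ≠ b) ∧
      ∀ i S', ds[i]? = some (some S') → Ready p q k cs cs' S Tp Tq (G.child i)) := by
  obtain ⟨hs, hr, hl, hp, hq⟩ := h
  have hp' := hp.unfold
  have hq' := hq.unfold
  by_cases hpa : p = a
  · subst hpa
    have h₁ := (hp'.2.2.1 b ds hG).1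
    simp only [hs, Option.some.injEq, LHead.sendH.injEq] at h₁
    obtain ⟨rfl, rfl⟩ := h₁
    have h₂ := (hq'.2.1 p cs hG).1
    simp only [hr, Option.some.injEq, LHead.recvH.injEq] at h₂
    exact .inl ⟨rfl, rfl, rfl, h₂.2.symm⟩
  by_cases hpb : p = b
  · subst hpb
    have h₁ := (hp'.2.1 a ds hG).1
    simp [hs] at h₁
  by_cases hqa : q = a
  · subst hqa
    have h₁ := (hq'.2.2.1 b ds hG).1
    simp [hr] at h₁
  by_cases hqb : q = b
  · subst hqb
    have h₁ := (hq'.2.1 a ds hG).1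
    simp only [hr, Option.some.injEq, LHead.recvH.injEq] at h₁
    exact absurd h₁.1 hpa
  exact .inr ⟨⟨hpa, hpb, hqa, hqb⟩, fun i S' hi =>
    ⟨hs, hr, hl, hp'.2.2.2 a b ds hG hpa hpb i S' hi, hq'.2.2.2 a b ds hG hqa hqb i S' hi⟩⟩

theorem Ready.branches_eq (h : Ready p q k cs cs' S Tp Tq G) : cs = cs' := by
  have hp := h.isPart
  induction hp with
  | here hG hpq =>
    rcases h.head hG with h | ⟨h, -⟩
    · exact h.2.2.2
    · exact absurd hpq (by tauto)
  | there hG hi _ ih =>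
    rcases h.head hG with h | ⟨-, h⟩
    · exact h.2.2.2
    · exact ih (h _ _ hi)

theorem Ready.proj_child_of_head (h : Ready p q k cs cs' S Tp Tq G)
    (hG : G.node [] = some (.commH p q cs)) {r : Prt} {t : Ltt}
    (ht : NextProj p q k Tp Tq G r t) : Proj (G.exec p q k) r t := by
  rw [Gtt.exec_of_head hG h.label]
  rcases ht with ⟨rfl, rfl⟩ | ⟨rfl, rfl⟩ | ⟨hp, hq, ht⟩
  · exact (h.projSend.unfold.2.2.1 q cs hG).2 k S h.label
  · exact (h.projRecv.unfold.2.1 p cs hG).2 k S h.label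
  · exact ht.unfold.2.2.2 p q cs hG hp hq k S h.label

theorem NextProj.child {r : Prt} {t : Ltt} (ht : NextProj p q k Tp Tq G r t)
    {a b : Prt} {ds : List (Option Srt)} (hG : G.node [] = some (.commH a b ds))
    (ha : r ≠ a) (hb : r ≠ b) {i : ℕ} {S' : Srt} (hi : ds[i]? = some (some S')) :
    NextProj p q k Tp Tq (G.child i) r t := by
  rcases ht with h | h | ⟨hp, hq, ht⟩
  · exact .inl h
  · exact .inr (.inl h)
  · exact .inr (.inr ⟨hp, hq, ht.unfold.2.2.2 a b ds hG ha hb i S' hi⟩)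

theorem Ready.end_of_not_isPart (h : Ready p q k cs cs' S Tp Tq G) {r : Prt} {t : Ltt}
    (ht : NextProj p q k Tp Tq G r t) (hr : ¬ IsPart r (G.exec p q k)) :
    t.node [] = some .endH := by
  have hp := h.isPart
  induction hp with
  | here hG hpq =>
    rcases h.head hG with ⟨rfl, rfl, rfl, rfl⟩ | ⟨hne, -⟩
    · exact (h.proj_child_of_head hG ht).unfold.1 hr
    · exact absurd hpq (by tauto)
  | @there G a b ds i S' hG hi _ ih =>
    rcases h.head hG with ⟨rfl, rfl, rfl, rfl⟩ | ⟨hne, hc⟩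
    · exact (h.proj_child_of_head hG ht).unfold.1 hr
    · have hn := Gtt.exec_node_root (q := q) (k := k) hG hne.1.symm
      have hab : ¬ (r = a ∨ r = b) := fun hab => hr (.here hn hab)
      push Not at hab
      refine ih (hc i S' hi) (ht.child hG hab.1 hab.2 hi) fun hpart => hr ?_
      refine .there hn hi ?_
      rwa [Gtt.exec_child hG hne.1.symm hi]

/-- Executing a communication commutes with projection. -/
theorem Ready.proj_exec (h : Ready p q k cs cs' S Tp Tq G) {r : Prt} {t : Ltt}
    (ht : NextProj p q k Tp Tq G r t) : Proj (G.exec p q k) r t := by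
  let R : Gtt → Prt → Ltt → Prop := fun g r t =>
    Proj g r t ∨ ∃ G, Ready p q k cs cs' S Tp Tq G ∧ g = G.exec p q k ∧
      NextProj p q k Tp Tq G r t
  refine ⟨R, ?_, .inr ⟨G, h, rfl, ht⟩⟩
  rintro g r t (hg | ⟨G, h, rfl, ht⟩)
  · exact hg.unfold.mono fun _ _ _ => .inl
  obtain ⟨a, b, ds, hG⟩ : ∃ a b ds, G.node [] = some (.commH a b ds) := by
    cases h.isPart with
    | here hG _ => exact ⟨_, _, _, hG⟩
    | there hG _ _ => exact ⟨_, _, _, hG⟩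
  rcases h.head hG with ⟨rfl, rfl, rfl, rfl⟩ | ⟨hne, hc⟩
  · exact (h.proj_child_of_head hG ht).unfold.mono fun _ _ _ => .inl
  have hn := Gtt.exec_node_root (q := q) (k := k) hG hne.1.symm
  have hR : ∀ i S' u, ds[i]? = some (some S') → NextProj p q k Tp Tq (G.child i) r u →
      R ((G.exec p q k).child i) r u := fun i S' u hi hu =>
    .inr ⟨_, hc i S' hi, Gtt.exec_child hG hne.1.symm hi, hu⟩
  refine ⟨h.end_of_not_isPart ht, fun a' ds' h' => ?_, fun b' ds' h' => ?_,
    fun a' b' ds' h' ha hb i S' hi => ?_⟩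
  · simp only [hn, Option.some.injEq, GHead.commH.injEq] at h'
    obtain ⟨rfl, rfl, rfl⟩ := h'
    rcases ht with ⟨rfl, -⟩ | ⟨rfl, -⟩ | ⟨hp, hq, ht⟩
    · exact absurd rfl hne.2.1
    · exact absurd rfl hne.2.2.2
    · have := ht.unfold.2.1 a ds hG
      exact ⟨this.1, fun i S' hi => hR i S' _ hi (.inr (.inr ⟨hp, hq, this.2 i S' hi⟩))⟩
  · simp only [hn, Option.some.injEq, GHead.commH.injEq] at h'
    obtain ⟨rfl, rfl, rfl⟩ := h'
    rcases ht with ⟨rfl, -⟩ | ⟨rfl, -⟩ | ⟨hp, hq, ht⟩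
    · exact absurd rfl hne.1
    · exact absurd rfl hne.2.2.1
    · have := ht.unfold.2.2.1 b ds hG
      exact ⟨this.1, fun i S' hi => hR i S' _ hi (.inr (.inr ⟨hp, hq, this.2 i S' hi⟩))⟩
  · simp only [hn, Option.some.injEq, GHead.commH.injEq] at h'
    obtain ⟨rfl, rfl, rfl⟩ := h'
    exact hR i S' t hi (ht.child hG ha hb hi)

end Ready

/-! ## Characterisation of environment communications -/

/-- Explicit description of the environment transitions with a given label. -/
def EStepSpec (Γ : Env) (α : TLabel) (Γ' : Env) : Prop :=
  match α with
  | .sendL p q S k => ∃ T cs, Γ p = some T ∧ T.node [] = some (.sendH q cs) ∧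
      cs[k]? = some (some S) ∧ Γ' = Γ.upd p (T.child k)
  | .recvL p q S k => ∃ T cs, Γ p = some T ∧ T.node [] = some (.recvH q cs) ∧
      cs[k]? = some (some S) ∧ Γ' = Γ.upd p (T.child k)
  | .commL p q k => p ≠ q ∧ ∃ Tp Tq cs cs' S S', Γ p = some Tp ∧ Γ q = some Tq ∧
      Tp.node [] = some (.sendH q cs) ∧ Tq.node [] = some (.recvH p cs') ∧
      cs[k]? = some (some S) ∧ cs'[k]? = some (some S') ∧
      Γ' = (Γ.upd p (Tp.child k)).upd q (Tq.child k)

theorem EStep.spec {Γ Γ' : Env} {α : TLabel} (h : EStep Γ α Γ') : EStepSpec Γ α Γ' := by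
  induction h with
  | @recv p q T cs k S hT hk =>
    refine ⟨T, cs, by simp [Env.single], hT, hk, ?_⟩
    funext r
    by_cases hr : r = p <;> simp [Env.single, Env.upd, hr]
  | @send p q T cs k S hT hk =>
    refine ⟨T, cs, by simp [Env.single], hT, hk, ?_⟩
    funext r
    by_cases hr : r = p <;> simp [Env.single, Env.upd, hr]
  | @ext Γ Γ' α a U _ ha ih =>
    have hne : ∀ {r T}, Γ r = some T → r ≠ a := by
      rintro r T hr rfl
      simp [ha] at hr
    cases α with
    | recvL p q S k =>
      obtain ⟨T, cs, hp, hT, hk, rfl⟩ := ih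
      have := hne hp
      refine ⟨T, cs, by simp [Env.upd, this, hp], hT, hk, ?_⟩
      funext r
      simp only [Env.upd]
      split_ifs <;> simp_all
    | sendL p q S k =>
      obtain ⟨T, cs, hp, hT, hk, rfl⟩ := ih
      have := hne hp
      refine ⟨T, cs, by simp [Env.upd, this, hp], hT, hk, ?_⟩
      funext r
      simp only [Env.upd]
      split_ifs <;> simp_all
    | commL p q k =>
      obtain ⟨hpq, Tp, Tq, cs, cs', S, S', hp, hq, hTp, hTq, hk, hk', rfl⟩ := ih
      have hpa := hne hp
      have hqa := hne hq
      refine ⟨hpq, Tp, Tq, cs, cs', S, S', by simp [Env.upd, hpa, hp], by simp [Env.upd, hqa, hq],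
        hTp, hTq, hk, hk', ?_⟩
      funext r
      simp only [Env.upd]
      split_ifs <;> simp_all
  | @comm Γ₁ Γ₁' Γ₂ Γ₂' p q S S' k _ _ _ hd ih₁ ih₂ =>
    obtain ⟨Tp, cs, hp, hTp, hk, rfl⟩ := ih₁
    obtain ⟨Tq, cs', hq, hTq, hk', rfl⟩ := ih₂
    have hq₁ : Γ₁ q = none := (hd q).resolve_right (by simp [hq])
    have hpq : p ≠ q := by
      rintro rfl
      simp [hp] at hq₁
    refine ⟨hpq, Tp, Tq, cs, cs', S, S', by simp [Env.union, hp], by simp [Env.union, hq₁, hq],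
      hTp, hTq, hk, hk', ?_⟩
    funext r
    by_cases hrq : r = q
    · subst hrq
      simp [Env.union, Env.upd, hq₁, hpq.symm]
    · by_cases hrp : r = p
      · subst hrp
        simp [Env.union, Env.upd, hrq]
      · simp [Env.union, Env.upd, hrp, hrq]

/-- Framing an environment transition by the part of `D` supported on a finite set. -/
theorem EStep.frame {Γ Γ' : Env} {α : TLabel} (h : EStep Γ α Γ') (D : Env) (s : Finset Prt) :
    (∀ r ∈ s, Γ r = none ∧ Γ' r = none) →
    EStep (fun r => if r ∈ s then D r else Γ r) α (fun r => if r ∈ s then D r else Γ' r) := by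
  induction s using Finset.induction_on with
  | empty => intro _; simpa using h
  | insert a s ha ih =>
    intro hs
    have ih := ih fun r hr => hs r (Finset.mem_insert_of_mem hr)
    obtain ⟨hΓ, hΓ'⟩ := hs a (Finset.mem_insert_self a s)
    cases hD : D a with
    | none =>
      convert ih using 2 with r r
      all_goals
        by_cases hr : r = a
        · subst hr
          simp [ha, hD, hΓ, hΓ']
        · simp [hr]
    | some T =>
      convert ih.ext (p := a) (T := T) (by simp [ha, hΓ]) using 2 with r r
      all_goals
        by_cases hr : r = a
        · subst hr
          simp [hD, Env.upd]
        · simp [hr, Env.upd]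

theorem EStep.comm_of_fin {Γ : Env} (hfin : EnvFin Γ) {p q : Prt} {k : ℕ} {Tp Tq : Ltt}
    {cs cs' : List (Option Srt)} {S S' : Srt} (hpq : p ≠ q)
    (hp : Γ p = some Tp) (hq : Γ q = some Tq)
    (hTp : Tp.node [] = some (.sendH q cs)) (hTq : Tq.node [] = some (.recvH p cs'))
    (hk : cs[k]? = some (some S)) (hk' : cs'[k]? = some (some S')) (hS : Subsort S S') :
    EStep Γ (.commL p q k) ((Γ.upd p (Tp.child k)).upd q (Tq.child k)) := by
  have h₀ := EStep.comm (EStep.send hTp hk) (EStep.recv hTq hk') hS (by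
    intro r
    by_cases hr : r = p
    · right
      simp [Env.single, hr, hpq]
    · left
      simp [Env.single, hr])
  have h := h₀.frame Γ (hfin.toFinset \ {p, q}) (by
    intro r hr
    simp only [Finset.mem_sdiff, Finset.mem_insert, Finset.mem_singleton, not_or] at hr
    simp [Env.union, Env.single, hr.2.1, hr.2.2])
  convert h using 2 with r r
  all_goals
    by_cases hrp : r = p
    · subst hrp
      simp [Env.union, Env.single, Env.upd, hpq, hp]
    by_cases hrq : r = q
    · subst hrq
      simp [Env.union, Env.single, Env.upd, hpq.symm, hq]
    by_cases hr : Γ r = none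
    · simp [Env.union, Env.single, Env.upd, hrp, hrq, hr]
    · have hmem : r ∈ hfin.toFinset := hfin.mem_toFinset.2 hr
      simp [Env.upd, hrp, hrq, hmem]

theorem EnvFin.upd {Γ : Env} (h : EnvFin Γ) (p : Prt) (T : Ltt) : EnvFin (Γ.upd p T) := by
  refine (h.insert p).subset fun r hr => ?_
  by_cases hrp : r = p
  · exact .inl hrp
  · right
    simpa [Env.upd, hrp] using hr

/-! ## Simulation -/

/-- `Γ'` consists of projections of one global type tree and dominates `Γ` pointwise; outside
the domain of `Γ'`, the environment `Γ` is terminated. -/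
def Simulated (Γ Γ' : Env) : Prop :=
  EnvFin Γ' ∧ ∃ G, ∀ r,
    (∃ T T', Γ r = some T ∧ Γ' r = some T' ∧ Proj G r T' ∧ SubT T T') ∨
    (Γ' r = none ∧ ∀ T, Γ r = some T → T.node [] = some .endH)

theorem Simulated.exists_of_node {Γ Γ' : Env} {G : Gtt} {r : Prt} {T : Ltt} {h : LHead}
    (hr : (∃ T T', Γ r = some T ∧ Γ' r = some T' ∧ Proj G r T' ∧ SubT T T') ∨
      (Γ' r = none ∧ ∀ T, Γ r = some T → T.node [] = some .endH))
    (hT : Γ r = some T) (hn : T.node [] = some h) (hne : h ≠ .endH) :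
    ∃ T', Γ' r = some T' ∧ Proj G r T' ∧ SubT T T' := by
  rcases hr with ⟨T₁, T', h₁, h'⟩ | ⟨-, hend⟩
  · obtain rfl : T = T₁ := by simpa [hT] using h₁
    exact ⟨T', h'⟩
  · have := hend T hT
    simp_all

theorem Simulated.step {Γ Γ' Γ₁ : Env} {p q : Prt} {k : ℕ} (h : Simulated Γ Γ')
    (hs : EStep Γ (.commL p q k) Γ₁) :
    ∃ Γ₁', EStep Γ' (.commL p q k) Γ₁' ∧ Simulated Γ₁ Γ₁' := by
  obtain ⟨hfin, G, hG⟩ := h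
  obtain ⟨hpq, Tp, Tq, cs, cs', S, S', hp, hq, hTp, hTq, hk, hk', rfl⟩ := hs.spec
  obtain ⟨Up, hUp, hPp, hsp⟩ := Simulated.exists_of_node (hG p) hp hTp (by simp)
  obtain ⟨Uq, hUq, hPq, hsq⟩ := Simulated.exists_of_node (hG q) hq hTq (by simp)
  obtain ⟨ds, V, hUpn, hds, hsubp⟩ : ∃ ds V, Up.node [] = some (.sendH q ds) ∧
      ds[k]? = some (some V) ∧ SubT (Tp.child k) (Up.child k) := by
    rcases hsp.unfold with h | ⟨a, es, es', h, -⟩ | ⟨a, es, es', h, h', hc⟩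
    · simp [hTp] at h
    · simp [hTp] at h
    · simp only [hTp, Option.some.injEq, LHead.sendH.injEq] at h
      obtain ⟨rfl, rfl⟩ := h
      obtain ⟨V, hV, -, hV'⟩ := hc k S hk
      exact ⟨es', V, h', hV, hV'⟩
  obtain ⟨ds', hUqn, hsubq⟩ : ∃ ds', Uq.node [] = some (.recvH p ds') ∧
      ∀ V, ds'[k]? = some (some V) → SubT (Tq.child k) (Uq.child k) := by
    rcases hsq.unfold with h | ⟨a, es, es', h, h', hc⟩ | ⟨a, es, es', h, -⟩
    · simp [hTq] at h
    · simp only [hTq, Option.some.injEq, LHead.recvH.injEq] at h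
      obtain ⟨rfl, rfl⟩ := h
      refine ⟨es', h', fun V hV => ?_⟩
      obtain ⟨-, -, -, h⟩ := hc k V hV
      exact h
    · simp [hTq] at h
  have hready : Ready p q k ds ds' V Up Uq G := ⟨hUpn, hUqn, hds, hPp, hPq⟩
  obtain rfl := hready.branches_eq
  refine ⟨_, EStep.comm_of_fin hfin hpq hUp hUq hUpn hUqn hds hds (.refl V),
    (hfin.upd _ _).upd _ _, G.exec p q k, fun r => ?_⟩
  by_cases hrq : r = q
  · subst hrq
    exact .inl ⟨Tq.child k, Uq.child k, by simp [Env.upd], by simp [Env.upd],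
      hready.proj_exec (.inr (.inl ⟨rfl, rfl⟩)), hsubq V hds⟩
  by_cases hrp : r = p
  · subst hrp
    exact .inl ⟨Tp.child k, Up.child k, by simp [Env.upd, hrq], by simp [Env.upd, hrq],
      hready.proj_exec (.inl ⟨rfl, rfl⟩), hsubp⟩
  simp only [Env.upd, hrp, hrq, if_false]
  rcases hG r with ⟨T, T', h, h', hP, hs⟩ | h
  · exact .inl ⟨T, T', h, h', hready.proj_exec (.inr (.inr ⟨hrp, hrq, hP⟩)), hs⟩
  · exact .inr h

theorem Assoc.simulated {G : Gtt} {Γ Γproj : Env} (hfin : EnvFin Γproj) (hassoc : Assoc Γ G)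
    (hpe : IsProjEnv G Γproj) : Simulated Γ Γproj := by
  refine ⟨hfin, G, fun r => ?_⟩
  by_cases hr : IsPart r G
  · obtain ⟨T, Tr, hT, hP, hs⟩ := hassoc.1 r hr
    obtain ⟨T', hT', hP'⟩ := hpe.1 r hr
    exact .inl ⟨T, T', hT, hT', hP', hs.of_proj hP hP'⟩
  · refine .inr ⟨hpe.2 r hr, fun T hT => ?_⟩
    rcases hassoc.2 r hr with h | ⟨T', h, hn⟩
    · simp [hT] at h
    · obtain rfl : T = T' := by simpa [hT] using h
      exact hn

open Classical in
/-- The states of the path from `Γ'` that simulates `ρ`. -/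
noncomputable def EnvPath.simStates (ρ : EnvPath) (Γ' : Env) : ℕ → Env
  | 0 => Γ'
  | n + 1 =>
    if h : ∃ Δ, EStep (ρ.simStates Γ' n) (.commL (ρ.lb n).1 (ρ.lb n).2.1 (ρ.lb n).2.2) Δ ∧
      Simulated (ρ.st (n + 1)) Δ then h.choose else ρ.simStates Γ' n

theorem EnvPath.simStates_succ {ρ : EnvPath} {Γ' : Env} {n : ℕ}
    (h : Simulated (ρ.st n) (ρ.simStates Γ' n)) (hn : ρ.alive n) :
    EStep (ρ.simStates Γ' n) (.commL (ρ.lb n).1 (ρ.lb n).2.1 (ρ.lb n).2.2)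
      (ρ.simStates Γ' (n + 1)) ∧ Simulated (ρ.st (n + 1)) (ρ.simStates Γ' (n + 1)) := by
  have hex := h.step (ρ.step n hn)
  rw [EnvPath.simStates, dif_pos hex]
  exact hex.choose_spec

theorem EnvPath.simulated_of_valid {ρ : EnvPath} {Γ' : Env} (h : Simulated (ρ.st 0) Γ') :
    ∀ n, ρ.valid n → Simulated (ρ.st n) (ρ.simStates Γ' n)
  | 0, _ => h
  | n + 1, hn => by
    have hv : ρ.valid n := by
      cases n with
      | zero => trivial
      | succ n => exact ρ.down n hn
    exact (EnvPath.simStates_succ (EnvPath.simulated_of_valid h n hv) hn).2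

/-- **Path simulation by the projection environment.** If `Γ ⊨ G` (`G` balanced,
projectable) and `Γproj = { p : G↾p | p ∈ parts(G) }`, then every environment reduction
path starting at `Γ` is matched by an environment reduction path starting at `Γproj`
with the very same sequence of transition labels, whose states are pointwise
supertypes of the corresponding states of the original path. -/
theorem path_simulation (G : Gtt) (Γ Γproj : Env)
    (hbal : BalancedG G) (hproj : Projectable G)
    (hfin : EnvFin Γ) (hfin' : EnvFin Γproj)
    (hassoc : Assoc Γ G) (hpe : IsProjEnv G Γproj)
    (ρ : EnvPath) (h0 : ρ.st 0 = Γ) :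
    ∃ ρ' : EnvPath, ρ'.st 0 = Γproj ∧
      (∀ n, ρ'.alive n ↔ ρ.alive n) ∧
      (∀ n, ρ.alive n → ρ'.lb n = ρ.lb n) ∧
      (∀ n, ρ.valid n → ∀ p T', ρ'.st n p = some T' →
        ∃ T, ρ.st n p = some T ∧ SubT T T') := by
  subst h0
  have hsim := EnvPath.simulated_of_valid (hassoc.simulated hfin' hpe)
  have hval : ∀ n, ρ.alive n → ρ.valid n := by
    rintro (_ | n) hn
    · trivial
    · exact ρ.down n hn
  refine ⟨⟨ρ.simStates Γproj, ρ.lb, ρ.alive, ρ.down, fun n hn =>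
    (EnvPath.simStates_succ (hsim n (hval n hn)) hn).1⟩, rfl, fun _ => Iff.rfl,
    fun _ _ => rfl, fun n hn r T' hT' => ?_⟩
  obtain ⟨-, G', hG'⟩ := hsim n hn
  rcases hG' r with ⟨T, U, hT, hU, -, hs⟩ | ⟨h, -⟩
  · obtain rfl : U = T' := Option.some.inj (hU.symm.trans hT')
    exact ⟨T, hT, hs⟩
  · exact absurd (h.symm.trans hT') (by simp)
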